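/- Let n be a squarefree even positive integer, let d = 4d₁ with d₁ a positive integer, and let b ∈ ℤ^d have every coordinate odd (so 4 divides b·b). Then g_n(b) = (−4)^{d₁} · n^{2d₁} · r(−(b·b)/4, n). -/

import Mathlib

open Finset

/-- `en n x = exp(2πi x / n)` -/
noncomputable def en (n : ℕ) (x : ℤ) : ℂ := Complex.exp (2 * Real.pi * Complex.I * x / n)

/-- `g_n(b) = Σ_{0 ≤ k < n, gcd(k,n)=1} Σ_{x ∈ {0,…,n-1}^d} e_n(b·x + k(x·x))`. -/
noncomputable def gsum (n d : ℕ) (b : Fin d → ℤ) : ℂ :=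
  ∑ k ∈ (Finset.range n).filter (fun k => Nat.gcd k n = 1),
    ∑ x ∈ Fintype.piFinset fun _ : Fin d => Finset.Ico (0:ℤ) n,
      en n (∑ i, b i * x i + k * ∑ i, x i ^ 2)

/-- The Ramanujan sum `r(c, n) = Σ_{0 ≤ k < n, gcd(k,n)=1} e_n(kc)`. -/
noncomputable def ram (c : ℤ) (n : ℕ) : ℂ :=
  ∑ k ∈ (Finset.range n).filter (fun k => Nat.gcd k n = 1), en n (k * c)

open ZMod

lemma en_eq_stdAddChar (n : ℕ) [NeZero n] (x : ℤ) : en n x = stdAddChar (x : ZMod n) :=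
  (stdAddChar_coe x).symm

lemma en_two_mul (m : ℕ) (x : ℤ) : en (2 * m) (2 * x) = en m x := by
  unfold en
  congr 1
  push_cast
  rcases eq_or_ne (m : ℂ) 0 with h | h
  · simp [h]
  · field_simp

lemma en_add (n : ℕ) (x y : ℤ) : en n (x + y) = en n x * en n y := by
  unfold en
  rw [← Complex.exp_add]
  push_cast
  ring_nf

lemma AddChar.map_sum_eq_prod {ι A M : Type*} [AddCommMonoid A] [CommMonoid M] (ψ : AddChar A M)
    (s : Finset ι) (f : ι → A) : ψ (∑ i ∈ s, f i) = ∏ i ∈ s, ψ (f i) :=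
  map_prod ψ.toMonoidHom (fun i => Multiplicative.ofAdd (f i)) s

lemma en_sum {ι : Type*} (n : ℕ) [NeZero n] (s : Finset ι) (f : ι → ℤ) :
    en n (∑ i ∈ s, f i) = ∏ i ∈ s, en n (f i) := by
  simp only [en_eq_stdAddChar, Int.cast_sum, AddChar.map_sum_eq_prod]

lemma en_two_mul_self_mul (m : ℕ) [NeZero m] (c : ℤ) : en (2 * m) (m * c) = (-1) ^ c := by
  have hm : (m : ℂ) ≠ 0 := NeZero.ne _
  rw [← Complex.exp_pi_mul_I, ← Complex.exp_int_mul]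
  unfold en
  congr 1
  push_cast
  field_simp

lemma en_two_mul_of_even {m : ℕ} [NeZero m] {h : ZMod m} (hh : 2 * h = 1) {z : ℤ}
    (hz : Even z) : en (2 * m) z = stdAddChar (h * (z : ZMod m)) := by
  obtain ⟨w, rfl⟩ := hz
  rw [← two_mul, en_two_mul, en_eq_stdAddChar]
  congr 1
  push_cast
  linear_combination (-(w : ZMod m)) * hh

lemma sum_range_natCast_zmod (m : ℕ) [NeZero m] (G : ZMod m → ℂ) :
    ∑ j ∈ range m, G j = ∑ x, G x := by
  refine sum_bij' (fun j _ => (j : ZMod m)) (fun x _ => x.val) (by simp)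
    (fun x _ => by simpa using ZMod.val_lt x) ?_ (by simp) (by simp)
  intro j hj
  exact ZMod.val_cast_of_lt (mem_range.1 hj)

lemma sum_Ico_two_mul_intCast_zmod (m : ℕ) [NeZero m] (G : ZMod m → ℂ) :
    ∑ x ∈ Ico (0 : ℤ) ((2 * m : ℕ) : ℤ), G x = 2 * ∑ x, G x := by
  have h : ∑ x ∈ Ico (0 : ℤ) ((2 * m : ℕ) : ℤ), G x = ∑ j ∈ range (2 * m), G j := by
    refine sum_bij' (fun x _ => x.toNat) (fun j _ => (j : ℤ)) ?_ ?_ ?_ (by simp) ?_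
    · intro x hx
      simp only [mem_Ico, mem_range] at hx ⊢
      omega
    · intro j hj
      simp only [mem_Ico, mem_range] at hj ⊢
      omega
    · intro x hx
      exact Int.toNat_of_nonneg (mem_Ico.1 hx).1
    · intro x hx
      congr 1
      rw [← Int.cast_natCast, Int.toNat_of_nonneg (mem_Ico.1 hx).1]
  rw [h, two_mul, sum_range_add]
  simp only [Nat.cast_add, CharP.cast_eq_zero, zero_add]
  rw [sum_range_natCast_zmod, two_mul]

lemma sum_coprime_two_mul_eq_sum_units {m : ℕ} [NeZero m] (hm : Odd m) (f : ZMod m → ℂ) :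
    ∑ k ∈ (range (2 * m)).filter (fun k => Nat.gcd k (2 * m) = 1), f k
      = ∑ u : (ZMod m)ˣ, f u := by
  have key : ∀ k : ℕ, Nat.gcd k (2 * m) = 1 ↔ Odd k ∧ Nat.Coprime k m := fun k => by
    rw [← Nat.coprime_iff_gcd_eq_one, Nat.coprime_mul_iff_right, Nat.coprime_two_right]
  have hmpos : 0 < m := NeZero.pos m
  refine sum_bij (fun k hk => unitOfCoprime k ((key k).1 (mem_filter.1 hk).2).2)
    (fun _ _ => mem_univ _) ?_ ?_ (fun k hk => by simp)
  · intro a ha b hb hab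
    have h1 : (a : ZMod m) = b := by simpa using congrArg Units.val hab
    have h2 : a ≡ b [MOD m] := (ZMod.natCast_eq_natCast_iff _ _ _).1 h1
    simp only [mem_filter, mem_range, key] at ha hb
    have h3 : a ≡ b [MOD 2] := by
      rw [Nat.ModEq, Nat.odd_iff.1 ha.2.1, Nat.odd_iff.1 hb.2.1]
    have h4 : a ≡ b [MOD 2 * m] :=
      (Nat.modEq_and_modEq_iff_modEq_mul (Nat.coprime_two_left.2 hm)).1 ⟨h3, h2⟩
    exact h4.eq_of_lt_of_lt ha.1 hb.1
  · intro u _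
    have hv := ZMod.val_lt (u : ZMod m)
    have hc := ZMod.val_coe_unit_coprime u
    rcases Nat.even_or_odd (u : ZMod m).val with he | ho
    · refine ⟨(u : ZMod m).val + m, ?_, Units.ext (by simp)⟩
      simp only [mem_filter, mem_range, key]
      exact ⟨by omega, he.add_odd hm, by simpa using hc⟩
    · refine ⟨(u : ZMod m).val, ?_, Units.ext (by simp)⟩
      simp only [mem_filter, mem_range, key]
      exact ⟨by omega, ho, hc⟩

lemma exists_sq_add_sq_modEq_neg_one {m : ℕ} (hm : Squarefree m) :
    ∃ a b : ℤ, a ^ 2 + b ^ 2 ≡ -1 [ZMOD m] := by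
  induction m using induction_on_primes with
  | zero => simp at hm
  | one => exact ⟨0, 0, by simpa using Int.modEq_one⟩
  | prime_mul p a hp ih =>
    obtain ⟨hcop, -, ha⟩ := Nat.squarefree_mul_iff.1 hm
    have := Fact.mk hp
    obtain ⟨x, y, -, -, hxy⟩ := Nat.sq_add_sq_zmodEq p (-1)
    obtain ⟨z, w, hzw⟩ := ih ha
    obtain ⟨r, s, hrs⟩ := (Nat.isCoprime_iff_coprime.2 hcop)
    obtain ⟨c, hc⟩ := hxy.dvd
    obtain ⟨e, he⟩ := hzw.dvd
    have hp' : ∀ t v : ℤ, t * (s * a) + v * (r * p) ≡ t [ZMOD p] := fun t v =>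
      (Int.modEq_iff_dvd.2 ⟨(t - v) * r, by linear_combination (-t) * hrs⟩)
    have ha' : ∀ t v : ℤ, t * (s * a) + v * (r * p) ≡ v [ZMOD a] := fun t v =>
      (Int.modEq_iff_dvd.2 ⟨(v - t) * s, by linear_combination (-v) * hrs⟩)
    refine ⟨x * (s * a) + z * (r * p), y * (s * a) + w * (r * p), ?_⟩
    rw [Nat.cast_mul, ← Int.modEq_and_modEq_iff_modEq_mul (by simpa using hcop)]
    exact ⟨(((hp' _ _).pow 2).add ((hp' _ _).pow 2)).trans hxy,
      (((ha' _ _).pow 2).add ((ha' _ _).pow 2)).trans hzw⟩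

/-- The quadratic Gauss sum `∑ x mod m, e_m(a x²)`. -/
noncomputable def quadGauss (m : ℕ) [NeZero m] (a : ZMod m) : ℂ :=
  ∑ x : ZMod m, stdAddChar (a * x ^ 2)

lemma quadGauss_sq (m : ℕ) [NeZero m] (a : ZMod m) :
    quadGauss m a ^ 2 = ∑ p : ZMod m × ZMod m, stdAddChar (a * (p.1 ^ 2 + p.2 ^ 2)) := by
  simp only [quadGauss, sq (∑ x : ZMod m, _), sum_mul_sum, Fintype.sum_prod_type, mul_add,
    AddChar.map_add_eq_mul]

lemma quadGauss_neg_sq {m : ℕ} [NeZero m] (hm : Squarefree m) (a : ZMod m) :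
    quadGauss m (-a) ^ 2 = quadGauss m a ^ 2 := by
  obtain ⟨α, β, h⟩ := exists_sq_add_sq_modEq_neg_one hm
  have h' : (α : ZMod m) ^ 2 + (β : ZMod m) ^ 2 = -1 := by
    exact_mod_cast (ZMod.intCast_eq_intCast_iff _ _ _).2 h
  rw [quadGauss_sq, quadGauss_sq]
  refine Fintype.sum_equiv
    { toFun := fun p : ZMod m × ZMod m => ((α : ZMod m) * p.1 - β * p.2, β * p.1 + α * p.2)
      invFun := fun p : ZMod m × ZMod m => (-((α : ZMod m) * p.1 + β * p.2), β * p.1 - α * p.2)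
      left_inv := fun p => Prod.ext (by linear_combination (-p.1) * h')
        (by linear_combination (-p.2) * h')
      right_inv := fun p => Prod.ext (by linear_combination (-p.1) * h')
        (by linear_combination (-p.2) * h') } _ _ fun p => ?_
  congr 1
  simp only [Equiv.coe_fn_mk]
  linear_combination (-a * (p.1 ^ 2 + p.2 ^ 2)) * h'

lemma quadGauss_mul_neg {m : ℕ} [NeZero m] {a h : ZMod m} (hh : 2 * h = 1) (ha : IsUnit a) :
    quadGauss m a * quadGauss m (-a) = m := by
  have e : quadGauss m a * quadGauss m (-a)
      = ∑ p : ZMod m × ZMod m, stdAddChar (a * (p.1 * p.2)) := by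
    simp only [quadGauss, sum_mul_sum, ← AddChar.map_add_eq_mul]
    rw [← Fintype.sum_prod_type']
    refine Fintype.sum_equiv
      { toFun := fun p => (p.1 + p.2, p.1 - p.2)
        invFun := fun p => (h * (p.1 + p.2), h * (p.1 - p.2))
        left_inv := fun p => Prod.ext (by linear_combination p.1 * hh)
          (by linear_combination p.2 * hh)
        right_inv := fun p => Prod.ext (by linear_combination p.1 * hh)
          (by linear_combination p.2 * hh) } _ _ fun p => ?_
    congr 1
    simp only [Equiv.coe_fn_mk]
    ring
  rw [e, Fintype.sum_prod_type]
  have inner (x : ZMod m) :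
      ∑ y : ZMod m, stdAddChar (a * (x * y)) = if x = 0 then (m : ℂ) else 0 := by
    have := AddChar.sum_mulShift (a * x) (isPrimitive_stdAddChar m)
    simp only [ha.mul_right_eq_zero, ZMod.card] at this
    rw [Nat.cast_ite, Nat.cast_zero] at this
    rw [← this]
    exact sum_congr rfl fun y _ => by congr 1; ring
  simp [inner]

lemma quadGauss_pow_four {m : ℕ} [NeZero m] (hm : Squarefree m) {a h : ZMod m}
    (hh : 2 * h = 1) (ha : IsUnit a) : quadGauss m a ^ 4 = (m : ℂ) ^ 2 := by
  rw [← quadGauss_mul_neg hh ha, mul_pow, quadGauss_neg_sq hm, ← pow_add]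

lemma sum_stdAddChar_quadratic {m : ℕ} [NeZero m] {a a' h : ZMod m} (hh : 2 * h = 1)
    (ha : a * a' = 1) (b : ZMod m) :
    ∑ x : ZMod m, stdAddChar (b * x + a * x ^ 2)
      = stdAddChar (-(h ^ 2 * a' * b ^ 2)) * quadGauss m a := by
  rw [quadGauss, mul_sum]
  refine Fintype.sum_equiv (Equiv.addRight (h * a' * b)) _ _ fun x => ?_
  rw [← AddChar.map_add_eq_mul]
  congr 1
  simp only [Equiv.coe_addRight]
  linear_combination (-b * x) * hh + (-2 * h * b * x - h ^ 2 * a' * b ^ 2) * ha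

lemma sum_en_two_mul_quadratic {m : ℕ} [NeZero m] {h k' : ZMod m} (hh : 2 * h = 1) {k b : ℤ}
    (hk : Odd k) (hb : Odd b) (hk' : (k : ZMod m) * k' = 1) :
    ∑ x ∈ Ico (0 : ℤ) ((2 * m : ℕ) : ℤ), en (2 * m) (b * x + k * x ^ 2)
      = 2 * (stdAddChar (-(h ^ 3 * k' * (b : ZMod m) ^ 2)) * quadGauss m (h * k)) := by
  have e (x : ℤ) : en (2 * m) (b * x + k * x ^ 2)
      = stdAddChar (h * (b : ZMod m) * (x : ZMod m) + h * (k : ZMod m) * (x : ZMod m) ^ 2) := by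
    rw [en_two_mul_of_even hh]
    · push_cast
      ring_nf
    · simp only [Int.even_add, Int.even_mul, Int.even_pow, Int.not_even_iff_odd.2 hk,
        Int.not_even_iff_odd.2 hb]
      simp
  simp only [e]
  rw [sum_Ico_two_mul_intCast_zmod m fun x => stdAddChar (h * (b : ZMod m) * x + h * (k : ZMod m) * x ^ 2),
    sum_stdAddChar_quadratic (a' := 2 * k') hh (by linear_combination 2 * h * hk' + hh)]
  congr 3
  linear_combination (-(h ^ 3 * k' * (b : ZMod m) ^ 2)) * hh

lemma gsum_eq_sum_prod (n d : ℕ) [NeZero n] (b : Fin d → ℤ) :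
    gsum n d b = ∑ k ∈ (range n).filter (fun k => Nat.gcd k n = 1),
      ∏ i, ∑ x ∈ Ico (0 : ℤ) n, en n (b i * x + k * x ^ 2) := by
  refine sum_congr rfl fun k _ => ?_
  rw [prod_univ_sum]
  refine sum_congr rfl fun x _ => ?_
  rw [← en_sum, sum_add_distrib, mul_sum]

lemma ram_two_mul {m : ℕ} [NeZero m] (hm : Odd m) {h : ZMod m} (hh : 2 * h = 1) (c : ℤ) :
    ram c (2 * m) = (-1) ^ c * ∑ u : (ZMod m)ˣ, stdAddChar (h * (u : ZMod m) * (c : ZMod m)) := by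
  rw [ram, ← sum_coprime_two_mul_eq_sum_units hm fun u : ZMod m => stdAddChar (h * u * (c : ZMod m)),
    mul_sum]
  refine sum_congr rfl fun k hk => ?_
  have hk2 : Odd k :=
    Nat.coprime_two_right.1 (Nat.Coprime.coprime_mul_right_right (mem_filter.1 hk).2)
  have hev : Even (((k : ℤ) - m) * c) := by
    refine Even.mul_right ?_ c
    exact Odd.sub_odd (by exact_mod_cast hk2) (by exact_mod_cast hm)
  rw [show (k : ℤ) * c = m * c + (k - m) * c by ring, en_add, en_two_mul_self_mul,
    en_two_mul_of_even hh hev]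
  congr 2
  push_cast
  simp
  ring

lemma gsum_two_mul {m d : ℕ} [NeZero m] (hm : Odd m) (hsf : Squarefree m) {h : ZMod m}
    (hh : 2 * h = 1) (b : Fin (4 * d) → ℤ) (hb : ∀ i, Odd (b i)) :
    gsum (2 * m) (4 * d) b = 4 ^ d * ((2 * m : ℕ) : ℂ) ^ (2 * d) *
      ∑ u : (ZMod m)ˣ, stdAddChar (h ^ 3 * (u : ZMod m) * ((-∑ i, b i ^ 2 : ℤ) : ZMod m)) := by
  rw [← Equiv.sum_comp (Equiv.inv (ZMod m)ˣ)]
  simp only [Equiv.inv_apply, ← ZMod.inv_coe_unit]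
  rw [gsum_eq_sum_prod, ← sum_coprime_two_mul_eq_sum_units hm fun u : ZMod m =>
    stdAddChar (h ^ 3 * u⁻¹ * ((-∑ i, b i ^ 2 : ℤ) : ZMod m)), mul_sum]
  refine sum_congr rfl fun k hk => ?_
  have hcop : Nat.Coprime k (2 * m) := (mem_filter.1 hk).2
  have hk2 : Odd k := Nat.coprime_two_right.1 hcop.coprime_mul_right_right
  have hk' : (k : ZMod m) * (k : ZMod m)⁻¹ = 1 :=
    ZMod.coe_mul_inv_eq_one k hcop.coprime_mul_left_right
  have hu : IsUnit (h * (k : ZMod m)) :=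
    IsUnit.of_mul_eq_one (2 * (k : ZMod m)⁻¹) (by linear_combination 2 * h * hk' + hh)
  rw [prod_congr rfl fun i _ => sum_en_two_mul_quadratic (k := k) hh (by exact_mod_cast hk2)
    (hb i) (by exact_mod_cast hk')]
  simp only [prod_mul_distrib, prod_const, card_univ, Fintype.card_fin, Int.cast_natCast]
  rw [pow_mul (quadGauss _ _), quadGauss_pow_four hsf hh hu, ← AddChar.map_sum_eq_prod]
  have e : ∑ i, -(h ^ 3 * (k : ZMod m)⁻¹ * (b i : ZMod m) ^ 2)
      = h ^ 3 * (k : ZMod m)⁻¹ * ((-∑ i, b i ^ 2 : ℤ) : ZMod m) := by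
    push_cast
    rw [sum_neg_distrib, mul_neg, mul_sum]
  rw [e]
  push_cast
  rw [mul_pow, ← pow_mul, pow_mul 2 4 d, pow_mul 2 2 d]
  have h16 : (2 ^ 4 : ℂ) ^ d = 4 ^ d * (2 ^ 2) ^ d := by rw [← mul_pow]; norm_num
  rw [h16]
  ring

lemma eight_dvd_sum_sq_sub_of_odd {d : ℕ} (b : Fin d → ℤ) (hb : ∀ i, Odd (b i)) :
    (8 : ℤ) ∣ ∑ i, b i ^ 2 - d := by
  have : ∑ i, b i ^ 2 - (d : ℤ) = ∑ i, (b i ^ 2 - 1) := by simp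
  rw [this]
  exact dvd_sum fun i _ => Int.eight_dvd_sq_sub_one_of_odd (hb i)

/-- For `n` squarefree even, `d = 4d₁` and all `b_i` odd,
`g_n(b) = (−4)^{d₁} n^{2d₁} r(−(b·b)/4, n)`. -/
theorem gsum_eq_case_d_four (n d₁ : ℕ) (hn : 0 < n) (hsf : Squarefree n) (hev : Even n)
    (hd₁ : 0 < d₁) (b : Fin (4 * d₁) → ℤ) (hb : ∀ i, Odd (b i))
    (hdvd : (4 : ℤ) ∣ ∑ i, b i ^ 2) :
    gsum n (4 * d₁) b = (-4 : ℂ) ^ d₁ * (n : ℂ) ^ (2 * d₁) * ram (-(∑ i, b i ^ 2) / 4) n := by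
  obtain ⟨m, rfl⟩ := hev.two_dvd
  obtain ⟨hcop, -, hm⟩ := Nat.squarefree_mul_iff.1 hsf
  have hodd : Odd m := Nat.coprime_two_left.1 hcop
  have : NeZero m := ⟨hm.ne_zero⟩
  have hh : (2 : ZMod m) * (2 : ZMod m)⁻¹ = 1 := by
    exact_mod_cast ZMod.coe_mul_inv_eq_one 2 hcop
  rw [gsum_two_mul hodd hm hh b hb, ram_two_mul hodd hh]
  have h8 := eight_dvd_sum_sq_sub_of_odd b hb
  obtain ⟨T, hT⟩ := hdvd
  have hdiv : -(∑ i, b i ^ 2) / 4 = -T := by omega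
  have hpar : Even (-T - d₁) := by
    rw [hT] at h8
    push_cast at h8
    rw [Int.even_iff]
    omega
  have hsign : (-1 : ℂ) ^ (-T) = (-1) ^ d₁ := by
    rw [← zpow_natCast, show -T = (-T - d₁) + d₁ by ring, zpow_add₀ (by norm_num),
      hpar.neg_one_zpow, one_mul]
  rw [hdiv, hsign, hT, show (-4 : ℂ) = -1 * 4 by norm_num, mul_pow]
  have e (u : (ZMod m)ˣ) : (2 : ZMod m)⁻¹ ^ 3 * u * ((-(4 * T) : ℤ) : ZMod m)
      = 2⁻¹ * u * ((-T : ℤ) : ZMod m) := by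
    push_cast
    linear_combination (-(2⁻¹ * u * T : ZMod m)) * (2 * 2⁻¹ + 1) * hh
  simp only [e]
  have hone : ((-1 : ℂ) ^ d₁) * (-1) ^ d₁ = 1 := by rw [← mul_pow]; norm_num
  linear_combination (-(4 ^ d₁ * ((2 * m : ℕ) : ℂ) ^ (2 * d₁) *
    ∑ u : (ZMod m)ˣ, stdAddChar (2⁻¹ * (u : ZMod m) * ((-T : ℤ) : ZMod m)))) * hone
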